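/- For any positive integer p, R(2p+1, 2p+1, 2p+1) = 2^{-6p-1} * sum_{j=0}^{p} binom(4p+1-2j, 2p) * (2^{6p+2} - 2^{2j-1} - 1) * zeta(2j) * zeta(6p+3-2j), with zeta(0) = -1/2. -/

import Mathlib

open Finset

noncomputable def tornheimR (s₁ s₂ s₃ : ℝ) : ℝ :=
  ∑' (m : ℕ) (n : ℕ),
    (-1 : ℝ) ^ (n + 1) /
      (((m : ℝ) + 1) ^ s₁ * ((n : ℝ) + 1) ^ s₂ * ((m : ℝ) + (n : ℝ) + 2) ^ s₃)

/-- The truncated binomial series `u ^ (a + 1) * ∑_{k ≤ b} C(a + k, k) * v ^ k` satisfies a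
Pascal-type recurrence. -/
theorem truncated_binomial_series_succ {R : Type*} [CommRing R] (u v : R) (a b : ℕ) :
    u ^ (a + 2) * ∑ k ∈ range (b + 2), ((a + 1 + k).choose k : R) * v ^ k =
      u * (u ^ (a + 1) * ∑ k ∈ range (b + 2), ((a + k).choose k : R) * v ^ k) +
        v * (u ^ (a + 2) * ∑ k ∈ range (b + 1), ((a + 1 + k).choose k : R) * v ^ k) := by
  rw [Finset.sum_range_succ' _ (b + 1), Finset.sum_range_succ' (fun k => ((a + k).choose k : R) * v ^ k)]
  have h : ∀ k ∈ range (b + 1), ((a + 1 + (k + 1)).choose (k + 1) : R) * v ^ (k + 1) =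
      v * (((a + 1 + k).choose k : R) * v ^ k) + ((a + (k + 1)).choose (k + 1) : R) * v ^ (k + 1) := by
    intro k _
    have : (a + 1 + (k + 1)).choose (k + 1) =
        (a + 1 + k).choose k + (a + (k + 1)).choose (k + 1) := by
      rw [← add_assoc (a + 1) k 1, Nat.choose_succ_succ, show a + 1 + k = a + (k + 1) by ring]
    rw [this]
    push_cast
    ring
  rw [Finset.sum_congr rfl h, Finset.sum_add_distrib, ← Finset.mul_sum]
  simp
  ring

theorem truncated_binomial_series_add_eq_one {R : Type*} [CommRing R] {u v : R} (h : u + v = 1)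
    (a b : ℕ) :
    u ^ (a + 1) * ∑ k ∈ range (b + 1), ((a + k).choose k : R) * v ^ k +
      v ^ (b + 1) * ∑ k ∈ range (a + 1), ((b + k).choose k : R) * u ^ k = 1 := by
  have base : ∀ {u v : R}, u + v = 1 → ∀ a : ℕ,
      u ^ (a + 1) + v * ∑ k ∈ range (a + 1), u ^ k = 1 := by
    intro u v h a
    obtain rfl : v = 1 - u := by rw [← h]; ring
    rw [mul_neg_geom_sum]
    ring
  induction a generalizing b with
  | zero =>
    have := base (add_comm u v ▸ h) b
    simp only [zero_add, Nat.choose_self, Nat.cast_one, one_mul, Finset.range_one,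
      Finset.sum_singleton, add_zero, Nat.choose_zero_right, pow_zero, mul_one, pow_one]
    rw [add_comm]
    exact this
  | succ a iha =>
    induction b with
    | zero => simpa using base h (a + 1)
    | succ b ihb =>
      have h1 := iha (b + 1)
      rw [truncated_binomial_series_succ u v a b, truncated_binomial_series_succ v u b a]
      linear_combination u * h1 + v * ihb + h

/-- Partial fraction decomposition of `1 / (x * y) ^ (a + 1)` with respect to `x + y`. -/
theorem one_div_mul_pow_eq_sum {K : Type*} [Field K] {x y : K} (hx : x ≠ 0) (hy : y ≠ 0)
    (hs : x + y ≠ 0) (a : ℕ) :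
    1 / (x ^ (a + 1) * y ^ (a + 1)) =
      ∑ i ∈ range (a + 1), ((2 * a - i).choose a : K) / (x + y) ^ (2 * a + 1 - i) *
        (1 / x ^ (i + 1) + 1 / y ^ (i + 1)) := by
  have h := truncated_binomial_series_add_eq_one
    (show x / (x + y) + y / (x + y) = 1 by rw [← add_div, div_self hs]) a a
  rw [← Finset.sum_range_reflect]
  have h2 : 1 / (x ^ (a + 1) * y ^ (a + 1)) = 1 / (x ^ (a + 1) * y ^ (a + 1)) *
    ((x / (x + y)) ^ (a + 1) * ∑ k ∈ range (a + 1), ((a + k).choose k : K) * (y / (x + y)) ^ k +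
      (y / (x + y)) ^ (a + 1) *
        ∑ k ∈ range (a + 1), ((a + k).choose k : K) * (x / (x + y)) ^ k) := by
    rw [h, mul_one]
  rw [h2, Finset.mul_sum, Finset.mul_sum, ← Finset.sum_add_distrib, Finset.mul_sum]
  refine Finset.sum_congr rfl fun k hk => ?_
  obtain ⟨c, rfl⟩ : ∃ c, a = c + k := ⟨a - k, by have := Finset.mem_range.1 hk; omega⟩
  rw [show c + k + 1 - 1 - k = c by omega, show 2 * (c + k) - c = c + k + k by omega,
    show 2 * (c + k) + 1 - c = c + k + k + 1 by omega, Nat.choose_symm_add]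
  simp only [div_pow]
  field_simp
  ring

theorem sum_range_choose_sub_eq (a : ℕ) :
    ∑ i ∈ range (a + 1), (2 * a - i).choose a = (2 * a + 1).choose a := by
  rw [← Finset.sum_range_reflect]
  have : ∀ i ∈ range (a + 1), (2 * a - (a + 1 - 1 - i)).choose a = (i + a).choose a := by
    intro i hi
    have := Finset.mem_range.1 hi
    congr 1
    omega
  rw [Finset.sum_congr rfl this, Nat.sum_range_add_choose, show a + a + 1 = 2 * a + 1 by ring]
  exact (Nat.choose_symm_half a)

theorem sum_range_odd_of_even_eq_zero {M : Type*} [AddCommMonoid M] {f : ℕ → M}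
    (hf : ∀ k, f (2 * k) = 0) (p : ℕ) :
    ∑ i ∈ range (2 * p + 1), f i = ∑ j ∈ range p, f (2 * j + 1) := by
  induction p with
  | zero => simpa using hf 0
  | succ p ih =>
    rw [show 2 * (p + 1) + 1 = 2 * p + 1 + 1 + 1 by ring, Finset.sum_range_succ,
      Finset.sum_range_succ, ih, Finset.sum_range_succ, show 2 * p + 1 + 1 = 2 * (p + 1) by ring,
      hf, add_zero]

/-- The bilateral sum `∑_{n ≠ 0} ε ^ n / n ^ i`, meant for `ε = 1` or `ε = -1`. -/
noncomputable def bilateralZeta (ε : ℝ) (i : ℕ) : ℝ :=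
  ∑' n : ℤ, ε ^ n / (n : ℝ) ^ i

theorem zpow_neg_of_eq_one_or_neg_one {ε : ℝ} (hε : ε = 1 ∨ ε = -1) (n : ℤ) :
    ε ^ (-n) = ε ^ n := by
  rcases hε with rfl | rfl
  · simp
  · rw [zpow_neg, ← inv_zpow]
    norm_num

theorem abs_zpow_of_eq_one_or_neg_one {ε : ℝ} (hε : ε = 1 ∨ ε = -1) (n : ℤ) :
    |ε ^ n| = 1 := by
  rcases hε with rfl | rfl <;> simp [abs_zpow]

theorem ne_zero_of_eq_one_or_neg_one {ε : ℝ} (hε : ε = 1 ∨ ε = -1) : ε ≠ 0 := by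
  rcases hε with rfl | rfl <;> norm_num

theorem summable_zpow_div_int_pow {ε : ℝ} (hε : ε = 1 ∨ ε = -1) {i : ℕ} (hi : 1 < i) :
    Summable fun n : ℤ => ε ^ n / (n : ℝ) ^ i := by
  refine Summable.of_norm ?_
  refine (Real.summable_one_div_int_pow.2 hi).norm.congr fun n => ?_
  rw [norm_div, norm_div, Real.norm_eq_abs (ε ^ n), abs_zpow_of_eq_one_or_neg_one hε, norm_one]

theorem bilateralZeta_eq_zero_of_odd {ε : ℝ} (hε : ε = 1 ∨ ε = -1) {i : ℕ} (hi : Odd i) :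
    bilateralZeta ε i = 0 := by
  have h : bilateralZeta ε i = -bilateralZeta ε i := by
    unfold bilateralZeta
    rw [← tsum_neg, ← (Equiv.neg ℤ).tsum_eq]
    refine tsum_congr fun n => ?_
    simp only [Equiv.neg_apply, Int.cast_neg, hi.neg_pow, zpow_neg_of_eq_one_or_neg_one hε]
    rw [div_neg]
  linarith

theorem summable_zpow_mul_one_div_sub_one_div_succ {ε : ℝ} (hε : ε = 1 ∨ ε = -1) :
    Summable fun n : ℤ => ε ^ n * (1 / (n : ℝ) - 1 / ((n : ℝ) + 1)) := by
  have h2 := Real.summable_one_div_int_pow.2 one_lt_two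
  have h3 : Summable fun n : ℤ => 1 / ((n : ℝ) + 1) ^ 2 := by
    simpa [Function.comp_def] using (Equiv.addRight (1 : ℤ)).summable_iff.2 h2
  refine Summable.of_norm_bounded (h2.add h3) fun n => ?_
  rw [Real.norm_eq_abs, abs_mul, abs_zpow_of_eq_one_or_neg_one hε, one_mul]
  by_cases h0 : n = 0
  · simp [h0]
  by_cases h1 : n = -1
  · simp [h1]
  have h0' : (n : ℝ) ≠ 0 := by exact_mod_cast h0
  have h1' : (n : ℝ) + 1 ≠ 0 := by
    intro h
    exact h1 (by have : n + 1 = 0 := by exact_mod_cast h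
                 omega)
  have key : 1 / (n : ℝ) - 1 / ((n : ℝ) + 1) = 1 / (n : ℝ) * (1 / ((n : ℝ) + 1)) := by
    field_simp
    ring
  rw [key, ← one_div_pow, ← one_div_pow, abs_le]
  constructor <;>
    nlinarith [sq_nonneg (1 / (n : ℝ) + 1 / ((n : ℝ) + 1)), sq_nonneg (1 / (n : ℝ) - 1 / ((n : ℝ) + 1)),
      sq_nonneg (1 / (n : ℝ)), sq_nonneg (1 / ((n : ℝ) + 1))]

theorem hasSum_zpow_mul_one_div_sub_one_div_succ {ε : ℝ} (hε : ε = 1 ∨ ε = -1) :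
    HasSum (fun n : ℤ => ε ^ n * (1 / (n : ℝ) - 1 / ((n : ℝ) + 1))) 0 := by
  have hs := summable_zpow_mul_one_div_sub_one_div_succ hε
  rcases hε with rfl | rfl
  · have hN : HasSum (fun n : ℕ => 1 / (n : ℝ) - 1 / ((n : ℝ) + 1)) 0 := by
      have hsN : Summable fun n : ℕ => 1 / (n : ℝ) - 1 / ((n : ℝ) + 1) := by
        simpa [Function.comp_def] using hs.comp_injective Nat.cast_injective
      rw [hsN.hasSum_iff_tendsto_nat]
      have h : ∀ N : ℕ, ∑ n ∈ range N, (1 / (n : ℝ) - 1 / ((n : ℝ) + 1)) = -(1 / (N : ℝ)) := by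
        intro N
        have := Finset.sum_range_sub' (fun n : ℕ => 1 / (n : ℝ)) N
        push_cast at this
        rw [this]
        simp
      simp only [h]
      simpa using (tendsto_one_div_atTop_nhds_zero_nat (𝕜 := ℝ)).neg
    have := HasSum.of_nat_of_neg_add_one
      (f := fun n : ℤ => (1 : ℝ) ^ n * (1 / (n : ℝ) - 1 / ((n : ℝ) + 1))) (m := 0) (m' := 0)
      (by simpa using hN) (by
        convert hN using 2 with n
        push_cast
        rw [show -((n : ℝ) + 1) + 1 = -n by ring, div_neg, div_neg]
        simp
        ring)
    simpa using this
  · have h : ∑' n : ℤ, (-1 : ℝ) ^ n * (1 / (n : ℝ) - 1 / ((n : ℝ) + 1)) =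
        -∑' n : ℤ, (-1 : ℝ) ^ n * (1 / (n : ℝ) - 1 / ((n : ℝ) + 1)) := by
      rw [← tsum_neg]
      conv_lhs => rw [← (Equiv.subLeft (-1 : ℤ)).tsum_eq]
      refine tsum_congr fun n => ?_
      rw [Equiv.subLeft_apply, sub_eq_add_neg, zpow_add₀ (by norm_num),
        zpow_neg_of_eq_one_or_neg_one (Or.inr rfl) n]
      push_cast
      rw [show (-1 : ℝ) + -n + 1 = -n by ring, show (-1 : ℝ) + -n = -(n + 1) by ring, div_neg, div_neg]
      rw [show (-1 : ℝ) ^ (-1 : ℤ) = -1 by norm_num]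
      ring
    have h0 := hs.hasSum
    rwa [show ∑' n : ℤ, (-1 : ℝ) ^ n * (1 / (n : ℝ) - 1 / ((n : ℝ) + 1)) = 0 by linarith] at h0

theorem hasSum_zpow_mul_one_div_sub_one_div_add {ε : ℝ} (hε : ε = 1 ∨ ε = -1) (m : ℕ) :
    HasSum (fun n : ℤ => ε ^ n * (1 / (n : ℝ) - 1 / ((n : ℝ) + m))) 0 := by
  induction m with
  | zero => simp
  | succ m ih =>
    have h := (((Equiv.addRight (m : ℤ)).hasSum_iff).2
      (hasSum_zpow_mul_one_div_sub_one_div_succ hε)).mul_left (ε ^ (-(m : ℤ)))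
    convert ih.add h using 1
    · funext n
      simp only [Function.comp_apply, Equiv.coe_addRight, ← mul_assoc]
      rw [← zpow_add₀ (ne_zero_of_eq_one_or_neg_one hε), show -(m : ℤ) + (n + m) = n by ring]
      push_cast
      ring
    · simp

theorem hasSum_zpow_mul_one_div_neg_pow_add {ε : ℝ} (hε : ε = 1 ∨ ε = -1) (m : ℕ) (i : ℕ) :
    HasSum (fun n : ℤ => ε ^ n * (1 / (-(n : ℝ)) ^ (i + 1) + 1 / ((n : ℝ) + m) ^ (i + 1)))
      ((1 + ε ^ m) * bilateralZeta ε (i + 1)) := by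
  rcases Nat.eq_zero_or_pos i with rfl | hi
  · rw [bilateralZeta_eq_zero_of_odd hε (by simp), mul_zero]
    have h := (hasSum_zpow_mul_one_div_sub_one_div_add hε m).neg
    rw [neg_zero] at h
    have e : (fun n : ℤ => ε ^ n * (1 / (-(n : ℝ)) ^ (0 + 1) + 1 / ((n : ℝ) + m) ^ (0 + 1))) =
        fun n : ℤ => -(ε ^ n * (1 / (n : ℝ) - 1 / ((n : ℝ) + m))) := by
      funext n
      rw [zero_add, pow_one, pow_one, div_neg]
      ring
    rw [e]
    exact h
  · have h : HasSum (fun n : ℤ => ε ^ n / (n : ℝ) ^ (i + 1)) (bilateralZeta ε (i + 1)) :=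
      (summable_zpow_div_int_pow hε (by omega)).hasSum
    have h1 := (Equiv.neg ℤ).hasSum_iff.2 h
    have h2 := ((Equiv.addRight (m : ℤ)).hasSum_iff.2 h).mul_left (ε ^ (-(m : ℤ)))
    convert h1.add h2 using 1
    · funext n
      simp only [Function.comp_apply, Equiv.coe_addRight, Equiv.neg_apply, ← mul_div_assoc]
      rw [← zpow_add₀ (ne_zero_of_eq_one_or_neg_one hε), show -(m : ℤ) + (n + m) = n by ring,
        zpow_neg_of_eq_one_or_neg_one hε]
      push_cast
      ring
    · rw [zpow_neg_of_eq_one_or_neg_one hε, zpow_natCast]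
      ring

/-- Closed form of `∑_{n ≠ 0, -m} ε ^ n / (n * (n + m)) ^ (2 * p + 1)`. -/
theorem hasSum_zpow_div_mul_pow {ε : ℝ} (hε : ε = 1 ∨ ε = -1) (p : ℕ) {m : ℕ} (hm : m ≠ 0) :
    HasSum (fun n : ℤ => ε ^ n / ((n : ℝ) ^ (2 * p + 1) * ((n : ℝ) + m) ^ (2 * p + 1)))
      ((1 + ε ^ m) * (((4 * p + 1).choose (2 * p) : ℝ) / (m : ℝ) ^ (4 * p + 2) -
        ∑ j ∈ range p, ((4 * p - (2 * j + 1)).choose (2 * p) : ℝ) / (m : ℝ) ^ (4 * p - 2 * j) *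
          bilateralZeta ε (2 * j + 2))) := by
  have hm' : (m : ℝ) ≠ 0 := by exact_mod_cast hm
  set c : ℕ → ℝ := fun i => ((4 * p - i).choose (2 * p) : ℝ) / (m : ℝ) ^ (4 * p + 1 - i) with hc
  set B : ℝ := ((4 * p + 1).choose (2 * p) : ℝ) / (m : ℝ) ^ (4 * p + 2) with hB
  have hcB : ∑ i ∈ range (2 * p + 1), c i * (1 / (m : ℝ) ^ (i + 1)) = B := by
    have h := sum_range_choose_sub_eq (2 * p)
    rw [show 2 * (2 * p) = 4 * p by ring] at h
    rw [hB, ← h, Nat.cast_sum, Finset.sum_div]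
    refine Finset.sum_congr rfl fun i hi => ?_
    have := Finset.mem_range.1 hi
    rw [hc, div_mul_div_comm, mul_one, ← pow_add, show 4 * p + 1 - i + (i + 1) = 4 * p + 2 by omega]
  have hmain := (hasSum_sum (s := range (2 * p + 1)) fun i _ =>
    (hasSum_zpow_mul_one_div_neg_pow_add hε m i).mul_left (c i)).neg
  have htot := (hmain.add (hasSum_ite_eq (0 : ℤ) B)).add (hasSum_ite_eq (-(m : ℤ)) (ε ^ m * B))
  have hval : -∑ i ∈ range (2 * p + 1), c i * ((1 + ε ^ m) * bilateralZeta ε (i + 1)) + B +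
      ε ^ m * B = (1 + ε ^ m) * (B - ∑ j ∈ range p,
        ((4 * p - (2 * j + 1)).choose (2 * p) : ℝ) / (m : ℝ) ^ (4 * p - 2 * j) *
          bilateralZeta ε (2 * j + 2)) := by
    rw [sum_range_odd_of_even_eq_zero (fun k => by
      rw [bilateralZeta_eq_zero_of_odd hε (by simp), mul_zero, mul_zero]), mul_sub, Finset.mul_sum]
    have : ∀ j ∈ range p, c (2 * j + 1) * ((1 + ε ^ m) * bilateralZeta ε (2 * j + 1 + 1)) =
        (1 + ε ^ m) * (((4 * p - (2 * j + 1)).choose (2 * p) : ℝ) / (m : ℝ) ^ (4 * p - 2 * j) *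
          bilateralZeta ε (2 * j + 2)) := by
      intro j _
      simp only [hc]
      rw [show 4 * p + 1 - (2 * j + 1) = 4 * p - 2 * j by omega]
      ring
    rw [Finset.sum_congr rfl this]
    ring
  rw [hval] at htot
  refine (congrArg (fun f => HasSum f _) (funext fun n => ?_)).mp htot
  by_cases h0 : n = 0
  · have hne : (0 : ℤ) ≠ -(m : ℤ) := by omega
    subst h0
    simp only [Int.cast_zero, zpow_zero, neg_zero, zero_add, one_mul, if_true, if_neg hne]
    simp only [ne_eq, Nat.add_eq_zero_iff, one_ne_zero, and_false, not_false_eq_true, zero_pow,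
      div_zero, zero_mul, zero_add, hcB]
    ring
  by_cases h1 : n = -(m : ℤ)
  · subst h1
    simp only [Int.cast_neg, Int.cast_natCast, neg_neg, neg_add_cancel, if_true, if_neg h0,
      zpow_neg_of_eq_one_or_neg_one hε, zpow_natCast]
    simp only [ne_eq, Nat.add_eq_zero_iff, one_ne_zero, and_false, not_false_eq_true, zero_pow,
      div_zero, mul_zero, add_zero, mul_left_comm _ (ε ^ m), ← Finset.mul_sum, hcB]
    ring
  · have hx : -(n : ℝ) ≠ 0 := by simpa using h0
    have hy : (n : ℝ) + m ≠ 0 := by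
      intro h
      exact h1 (by have : n + (m : ℤ) = 0 := by exact_mod_cast h
                   omega)
    have hs : -(n : ℝ) + (n + m) = m := by ring
    have h := one_div_mul_pow_eq_sum hx hy (by rwa [hs]) (2 * p)
    rw [hs, show 2 * (2 * p) = 4 * p by ring, Odd.neg_pow (by simp)] at h
    rw [if_neg h0, if_neg h1, add_zero, add_zero]
    simp only [mul_left_comm _ (ε ^ n), ← Finset.mul_sum]
    rw [← h, neg_mul, div_neg]
    ring

/-- Splitting a bilateral sum over `n` at the poles `n = 0` and `n = -m`. -/
theorem tsum_int_zpow_div_mul_pow {ε : ℝ} (hε : ε = 1 ∨ ε = -1) {r : ℕ} (hr : Odd r) {m : ℕ}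
    (hs : Summable fun n : ℤ => ε ^ n / ((n : ℝ) ^ r * ((n : ℝ) + m) ^ r)) :
    ∑' n : ℤ, ε ^ n / ((n : ℝ) ^ r * ((n : ℝ) + m) ^ r) =
      ∑' n : ℕ, ε ^ n / ((n : ℝ) ^ r * ((m : ℝ) + n) ^ r) +
      ε ^ m * ∑' n : ℕ, ε ^ n / ((n : ℝ) ^ r * ((m : ℝ) + n) ^ r) -
      ∑ x ∈ antidiagonal m, ε ^ x.1 / ((x.1 : ℝ) ^ r * (x.2 : ℝ) ^ r) := by
  have hr0 : r ≠ 0 := hr.pos.ne'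
  set t : ℤ → ℝ := fun n : ℤ => ε ^ n / ((n : ℝ) ^ r * ((n : ℝ) + m) ^ r) with ht
  have hpos : Summable fun n : ℕ => t n := hs.comp_injective Nat.cast_injective
  have hneg : Summable fun n : ℕ => t (-n) :=
    hs.comp_injective (i := fun n : ℕ => -(n : ℤ)) (neg_injective.comp Nat.cast_injective)
  have h := hs.hasSum.nat_add_neg.tsum_eq
  rw [hpos.tsum_add hneg, ← hneg.sum_add_tsum_nat_add m] at h
  have ht0 : t 0 = 0 := by simp [ht, hr0]
  have hp : ∀ n : ℕ, t n = ε ^ n / ((n : ℝ) ^ r * ((m : ℝ) + n) ^ r) := by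
    intro n
    simp [ht, add_comm]
  have hn : ∀ n : ℕ, t (-((n + m : ℕ) : ℤ)) =
      ε ^ m * (ε ^ n / ((n : ℝ) ^ r * ((m : ℝ) + n) ^ r)) := by
    intro n
    simp only [ht, zpow_neg_of_eq_one_or_neg_one hε, zpow_natCast]
    push_cast
    rw [show -((n : ℝ) + m) + m = -n by ring, hr.neg_pow, hr.neg_pow, neg_mul_neg, pow_add]
    ring
  have hmid : ∑ n ∈ range m, t (-(n : ℤ)) =
      -∑ x ∈ antidiagonal m, ε ^ x.1 / ((x.1 : ℝ) ^ r * (x.2 : ℝ) ^ r) := by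
    rw [Finset.Nat.sum_antidiagonal_eq_sum_range_succ_mk, Finset.sum_range_succ, Nat.sub_self,
      Nat.cast_zero, zero_pow hr0, mul_zero, div_zero, add_zero, ← Finset.sum_neg_distrib]
    refine Finset.sum_congr rfl fun n hn => ?_
    rw [Nat.cast_sub (Finset.mem_range.1 hn).le]
    simp only [ht, zpow_neg_of_eq_one_or_neg_one hε, zpow_natCast]
    push_cast
    rw [hr.neg_pow, show -(n : ℝ) + m = m - n by ring, neg_mul, div_neg]
  simp only [hp, hn, hmid, ht0, tsum_mul_left] at h
  linarith

/-- The summand of the Tornheim double series with all exponents equal to `r` and twisted by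
`α ^ m * β ^ n`; it vanishes when `m = 0` or `n = 0`. -/
noncomputable def tornheimTerm (r : ℕ) (α β : ℝ) (x : ℕ × ℕ) : ℝ :=
  α ^ x.1 * β ^ x.2 / ((x.1 : ℝ) ^ r * (x.2 : ℝ) ^ r * ((x.1 : ℝ) + x.2) ^ r)

noncomputable def tornheimSum (r : ℕ) (α β : ℝ) : ℝ :=
  ∑' x : ℕ × ℕ, tornheimTerm r α β x

theorem abs_pow_of_eq_one_or_neg_one {ε : ℝ} (hε : ε = 1 ∨ ε = -1) (n : ℕ) : |ε ^ n| = 1 := by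
  rcases hε with rfl | rfl <;> simp

theorem summable_tornheimTerm {r : ℕ} (hr : 1 < r) {α β : ℝ} (hα : α = 1 ∨ α = -1)
    (hβ : β = 1 ∨ β = -1) : Summable (tornheimTerm r α β) := by
  have h := Real.summable_one_div_nat_pow.2 hr
  refine Summable.of_norm_bounded
    (h.mul_of_nonneg h (fun n => by positivity) (fun n => by positivity)) fun x => ?_
  obtain ⟨m, n⟩ := x
  have hr0 : r ≠ 0 := by omega
  simp only [tornheimTerm, Real.norm_eq_abs, abs_div, abs_mul, abs_pow_of_eq_one_or_neg_one hα,
    abs_pow_of_eq_one_or_neg_one hβ]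
  rw [abs_of_nonneg (by positivity : (0 : ℝ) ≤ (m : ℝ) ^ r),
    abs_of_nonneg (by positivity : (0 : ℝ) ≤ (n : ℝ) ^ r),
    abs_of_nonneg (by positivity : (0 : ℝ) ≤ ((m : ℝ) + n) ^ r)]
  rcases Nat.eq_zero_or_pos m with rfl | hm
  · simp [hr0]
  rcases Nat.eq_zero_or_pos n with rfl | hn
  · simp [hr0]
  rw [one_mul, one_div_mul_one_div]
  have hm' : (1 : ℝ) ≤ m := by exact_mod_cast hm
  have hn' : (1 : ℝ) ≤ n := by exact_mod_cast hn
  have h1 : (1 : ℝ) ≤ ((m : ℝ) + n) ^ r := one_le_pow₀ (by linarith)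
  exact one_div_le_one_div_of_le (by positivity) (le_mul_of_one_le_right (by positivity) h1)

theorem tornheimSum_comm (r : ℕ) (α β : ℝ) : tornheimSum r α β = tornheimSum r β α := by
  unfold tornheimSum
  rw [← (Equiv.prodComm ℕ ℕ).tsum_eq]
  refine tsum_congr fun x => ?_
  simp only [tornheimTerm, Equiv.prodComm_apply, Prod.fst_swap, Prod.snd_swap]
  rw [add_comm (x.2 : ℝ), mul_comm (α ^ x.2), mul_comm ((x.2 : ℝ) ^ r)]

theorem hasSum_sum_antidiagonal {f : ℕ × ℕ → ℝ} (hf : Summable f) :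
    HasSum (fun n => ∑ x ∈ antidiagonal n, f x) (∑' x, f x) := by
  have h := (HasAntidiagonal.sigmaAntidiagonalEquivProd (A := ℕ)).hasSum_iff.2 hf.hasSum
  refine h.sigma fun n => ?_
  rw [← Finset.sum_coe_sort]
  exact hasSum_fintype _

theorem mul_eq_one_or_neg_one {α β : ℝ} (hα : α = 1 ∨ α = -1) (hβ : β = 1 ∨ β = -1) :
    α * β = 1 ∨ α * β = -1 := by
  rcases hα with rfl | rfl <;> rcases hβ with rfl | rfl <;> simp

theorem hasSum_pow_div_mul_tsum_int {r : ℕ} (hr : Odd r) (hr1 : 1 < r) {δ ε : ℝ}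
    (hδ : δ = 1 ∨ δ = -1) (hε : ε = 1 ∨ ε = -1)
    (hs : ∀ m : ℕ, m ≠ 0 →
      Summable fun n : ℤ => ε ^ n / ((n : ℝ) ^ r * ((n : ℝ) + m) ^ r)) :
    HasSum (fun m : ℕ => δ ^ m / (m : ℝ) ^ r *
        ∑' n : ℤ, ε ^ n / ((n : ℝ) ^ r * ((n : ℝ) + m) ^ r))
      (tornheimSum r δ ε + tornheimSum r (δ * ε) ε - tornheimSum r (δ * ε) δ) := by
  have hr0 : r ≠ 0 := by omega
  have hδε := mul_eq_one_or_neg_one hδ hε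
  have row : ∀ {α β : ℝ}, (α = 1 ∨ α = -1) → (β = 1 ∨ β = -1) →
      HasSum (fun m => ∑' n, tornheimTerm r α β (m, n)) (tornheimSum r α β) := fun hα hβ =>
    (summable_tornheimTerm hr1 hα hβ).hasSum.prod_fiberwise fun m =>
      ((summable_tornheimTerm hr1 hα hβ).prod_factor m).hasSum
  have h := ((row hδ hε).add (row hδε hε)).sub
    (hasSum_sum_antidiagonal (summable_tornheimTerm hr1 hδε hδ))
  refine (congrArg (fun f => HasSum f _) (funext fun m => ?_)).mp h
  rcases Nat.eq_zero_or_pos m with rfl | hm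
  · simp [tornheimTerm, hr0]
  have hrow : ∀ α : ℝ, ∑' n, tornheimTerm r α ε (m, n) =
      α ^ m / (m : ℝ) ^ r * ∑' n : ℕ, ε ^ n / ((n : ℝ) ^ r * ((m : ℝ) + n) ^ r) := by
    intro α
    rw [← tsum_mul_left]
    refine tsum_congr fun n => ?_
    rw [tornheimTerm, div_mul_div_comm, mul_assoc]
  have hdiag : ∑ x ∈ antidiagonal m, tornheimTerm r (δ * ε) δ x =
      δ ^ m / (m : ℝ) ^ r * ∑ x ∈ antidiagonal m, ε ^ x.1 / ((x.1 : ℝ) ^ r * (x.2 : ℝ) ^ r) := by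
    rw [Finset.mul_sum]
    refine Finset.sum_congr rfl fun x hx => ?_
    rw [← Finset.HasAntidiagonal.mem_antidiagonal.1 hx, tornheimTerm, div_mul_div_comm, Nat.cast_add, pow_add,
      mul_pow]
    congr 1 <;> ring
  rw [tsum_int_zpow_div_mul_pow hε hr (hs m hm.ne'), hrow, hrow, hdiag, mul_pow]
  ring

/-- The twisted zeta value `∑ m ≥ 1, ε ^ m / m ^ s`. -/
noncomputable def twistedZeta (ε : ℝ) (s : ℕ) : ℝ :=
  ∑' m : ℕ, ε ^ m / (m : ℝ) ^ s

theorem summable_pow_div_nat_pow {ε : ℝ} (hε : ε = 1 ∨ ε = -1) {s : ℕ} (hs : 1 < s) :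
    Summable fun m : ℕ => ε ^ m / (m : ℝ) ^ s := by
  simpa [Function.comp_def] using
    (summable_zpow_div_int_pow hε hs).comp_injective Nat.cast_injective

theorem bilateralZeta_eq_two_mul {ε : ℝ} (hε : ε = 1 ∨ ε = -1) {s : ℕ} (hs : Even s) (hs1 : 1 < s) :
    bilateralZeta ε s = 2 * twistedZeta ε s := by
  have h := (summable_zpow_div_int_pow hε hs1).hasSum.nat_add_neg.tsum_eq
  simp only [zpow_neg_of_eq_one_or_neg_one hε, zpow_natCast, Int.cast_neg, Int.cast_natCast,
    hs.neg_pow, Int.cast_zero, zero_pow (by omega : s ≠ 0), div_zero, add_zero, ← two_mul,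
    tsum_mul_left] at h
  exact h.symm

theorem twistedZeta_neg_one {s : ℕ} (hs : 1 < s) :
    twistedZeta (-1) s = (2 / 2 ^ s - 1) * twistedZeta 1 s := by
  have h1 := (summable_pow_div_nat_pow (Or.inl rfl) hs).hasSum
  have h2 := (summable_pow_div_nat_pow (Or.inr rfl) hs).hasSum
  have h3 := HasSum.even_add_odd
    (f := fun m : ℕ => (1 : ℝ) ^ m / (m : ℝ) ^ s + (-1) ^ m / (m : ℝ) ^ s)
    (m := 2 / 2 ^ s * twistedZeta 1 s) (m' := 0)
    (by
      refine (congrArg (fun f => HasSum f _) (funext fun m => ?_)).mp (h1.mul_left (2 / 2 ^ s))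
      simp only [one_pow, pow_mul, Nat.cast_mul, Nat.cast_ofNat, mul_pow, neg_one_sq]
      rw [div_mul_div_comm]
      ring)
    (by simp [pow_succ, pow_mul, neg_div, hasSum_zero])
  have := (h1.add h2).unique h3
  change twistedZeta 1 s + twistedZeta (-1) s = _ at this
  linarith

/-- Evaluation of the combination of twisted Tornheim series coming from a bilateral sum. -/
theorem tornheimSum_relation {p : ℕ} (hp : 1 ≤ p) {δ ε : ℝ} (hδ : δ = 1 ∨ δ = -1)
    (hε : ε = 1 ∨ ε = -1) :
    tornheimSum (2 * p + 1) δ ε + tornheimSum (2 * p + 1) (δ * ε) ε -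
        tornheimSum (2 * p + 1) (δ * ε) δ =
      ((4 * p + 1).choose (2 * p) : ℝ) *
        (twistedZeta δ (6 * p + 3) + twistedZeta (δ * ε) (6 * p + 3)) -
      ∑ j ∈ range p, ((4 * p - (2 * j + 1)).choose (2 * p) : ℝ) * (2 * twistedZeta ε (2 * j + 2)) *
        (twistedZeta δ (6 * p + 1 - 2 * j) + twistedZeta (δ * ε) (6 * p + 1 - 2 * j)) := by
  have hδε := mul_eq_one_or_neg_one hδ hε
  have h := hasSum_pow_div_mul_tsum_int (r := 2 * p + 1) (by simp) (by omega) hδ hε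
    fun m hm => (hasSum_zpow_div_mul_pow hε p hm).summable
  have pair : ∀ s : ℕ, 1 < s → HasSum (fun m : ℕ => δ ^ m / (m : ℝ) ^ s + (δ * ε) ^ m / (m : ℝ) ^ s)
      (twistedZeta δ s + twistedZeta (δ * ε) s) := fun s hs =>
    (summable_pow_div_nat_pow hδ hs).hasSum.add (summable_pow_div_nat_pow hδε hs).hasSum
  have h2 := ((pair (6 * p + 3) (by omega)).mul_left ((4 * p + 1).choose (2 * p) : ℝ)).sub
    (hasSum_sum (s := range p) fun j hj =>
      (pair (6 * p + 1 - 2 * j) (by have := Finset.mem_range.1 hj; omega)).mul_left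
        (((4 * p - (2 * j + 1)).choose (2 * p) : ℝ) * (2 * twistedZeta ε (2 * j + 2))))
  refine h.unique ((congrArg (fun f => HasSum f _) (funext fun m => ?_)).mp h2)
  rcases Nat.eq_zero_or_pos m with rfl | hm
  · have hz : ∑ j ∈ range p, ((4 * p - (2 * j + 1)).choose (2 * p) : ℝ) *
        (2 * twistedZeta ε (2 * j + 2)) * (δ ^ 0 / ((0 : ℕ) : ℝ) ^ (6 * p + 1 - 2 * j) +
          (δ * ε) ^ 0 / ((0 : ℕ) : ℝ) ^ (6 * p + 1 - 2 * j)) = 0 :=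
      Finset.sum_eq_zero fun j hj => by
        have := Finset.mem_range.1 hj
        have hne : 6 * p + 1 - 2 * j ≠ 0 := by omega
        rw [Nat.cast_zero, zero_pow hne, div_zero, div_zero, add_zero, mul_zero]
    rw [hz]
    simp
  rw [(hasSum_zpow_div_mul_pow hε p hm.ne').tsum_eq, mul_sub, mul_sub, Finset.mul_sum,
    Finset.mul_sum]
  have hm' : (m : ℝ) ≠ 0 := by exact_mod_cast hm.ne'
  congr 1
  · rw [show 6 * p + 3 = 2 * p + 1 + (4 * p + 2) by ring, pow_add (m : ℝ), mul_pow]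
    field_simp
  · refine Finset.sum_congr rfl fun j hj => ?_
    have := Finset.mem_range.1 hj
    rw [bilateralZeta_eq_two_mul hε (by simp [parity_simps]) (by omega),
      show 6 * p + 1 - 2 * j = 2 * p + 1 + (4 * p - 2 * j) by omega, pow_add (m : ℝ), mul_pow]
    field_simp

theorem tornheimR_eq_tornheimSum {r : ℕ} (hr : 1 < r) :
    tornheimR r r r = tornheimSum r 1 (-1) := by
  have hr0 : r ≠ 0 := by omega
  have hs := summable_tornheimTerm hr (Or.inl rfl : (1 : ℝ) = 1 ∨ _) (Or.inr rfl : (-1 : ℝ) = 1 ∨ _)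
  rw [tornheimSum, hs.tsum_prod, hs.prod.tsum_eq_zero_add, tornheimR]
  have h0 : ∑' n, tornheimTerm r 1 (-1) (0, n) = 0 := by simp [tornheimTerm, hr0]
  rw [h0, zero_add]
  refine tsum_congr fun m => ?_
  rw [(hs.prod_factor (m + 1)).tsum_eq_zero_add]
  have h1 : tornheimTerm r 1 (-1) (m + 1, 0) = 0 := by simp [tornheimTerm, hr0]
  rw [h1, zero_add]
  refine tsum_congr fun n => ?_
  simp only [tornheimTerm, Real.rpow_natCast, one_pow, one_mul]
  push_cast
  rw [show (m : ℝ) + 1 + (n + 1) = m + n + 2 by ring]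

theorem ofReal_twistedZeta_one {s : ℕ} (hs : 1 < s) :
    (twistedZeta 1 s : ℂ) = riemannZeta s := by
  rw [zeta_nat_eq_tsum_of_gt_one hs, twistedZeta, Complex.ofReal_tsum]
  simp

theorem two_mul_tornheimSum_one_neg_one {p : ℕ} (hp : 1 ≤ p) :
    2 * tornheimSum (2 * p + 1) 1 (-1) =
      ((4 * p + 1).choose (2 * p) : ℝ) *
        (2 / 2 ^ (6 * p + 3) + 2 * (2 / 2 ^ (6 * p + 3) - 1)) * twistedZeta 1 (6 * p + 3) -
      ∑ j ∈ range p, ((4 * p - (2 * j + 1)).choose (2 * p) : ℝ) * twistedZeta 1 (2 * j + 2) *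
        twistedZeta 1 (6 * p + 1 - 2 * j) *
          (2 * (2 / 2 ^ (2 * j + 2) - 1) * (2 / 2 ^ (6 * p + 1 - 2 * j)) +
            4 * (2 / 2 ^ (6 * p + 1 - 2 * j) - 1)) := by
  have h1 := tornheimSum_relation hp (Or.inl rfl : (1 : ℝ) = 1 ∨ _) (Or.inr rfl : (-1 : ℝ) = 1 ∨ _)
  have h2 := tornheimSum_relation hp (Or.inr rfl : (-1 : ℝ) = 1 ∨ _) (Or.inl rfl : (1 : ℝ) = 1 ∨ _)
  rw [one_mul] at h1
  rw [mul_one] at h2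
  have h3 := congrArg₂ (· + ·) h1 h2
  simp only [tornheimSum_comm (2 * p + 1) (-1) 1] at h3
  rw [twistedZeta_neg_one (by omega : 1 < 6 * p + 3)] at h3
  have hsum : ∀ j ∈ range p, ((4 * p - (2 * j + 1)).choose (2 * p) : ℝ) * twistedZeta 1 (2 * j + 2) *
        twistedZeta 1 (6 * p + 1 - 2 * j) *
          (2 * (2 / 2 ^ (2 * j + 2) - 1) * (2 / 2 ^ (6 * p + 1 - 2 * j)) +
            4 * (2 / 2 ^ (6 * p + 1 - 2 * j) - 1)) =
      ((4 * p - (2 * j + 1)).choose (2 * p) : ℝ) * (2 * twistedZeta (-1) (2 * j + 2)) *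
        (twistedZeta 1 (6 * p + 1 - 2 * j) + twistedZeta (-1) (6 * p + 1 - 2 * j)) +
      ((4 * p - (2 * j + 1)).choose (2 * p) : ℝ) * (2 * twistedZeta 1 (2 * j + 2)) *
        (twistedZeta (-1) (6 * p + 1 - 2 * j) + twistedZeta (-1) (6 * p + 1 - 2 * j)) := by
    intro j hj
    have := Finset.mem_range.1 hj
    rw [twistedZeta_neg_one (by omega : 1 < 2 * j + 2),
      twistedZeta_neg_one (by omega : 1 < 6 * p + 1 - 2 * j)]
    ring
  rw [Finset.sum_congr rfl hsum, Finset.sum_add_distrib]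
  linear_combination h3

theorem eval_R_odd_diag (p : ℕ) (hp : 1 ≤ p) :
    (tornheimR (2 * p + 1) (2 * p + 1) (2 * p + 1) : ℂ) =
      (2 : ℂ) ^ (-(6 * p : ℤ) - 1) * ∑ j ∈ Finset.range (p + 1),
        ((4 * p + 1 - 2 * j).choose (2 * p) : ℂ) *
          ((2 : ℂ) ^ ((6 * p : ℤ) + 2) - (2 : ℂ) ^ ((2 * j : ℤ) - 1) - 1) *
          riemannZeta (2 * j) * riemannZeta ((6 * p + 3 - 2 * j : ℕ)) := by
  have hR := tornheimR_eq_tornheimSum (r := 2 * p + 1) (by omega)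
  push_cast at hR
  have hS := congrArg (fun x : ℝ => (x : ℂ)) (two_mul_tornheimSum_one_neg_one hp)
  push_cast at hS
  have h2 : (2 : ℂ) ≠ 0 := two_ne_zero
  have hP : (2 : ℂ) ^ (6 * p) ≠ 0 := pow_ne_zero _ h2
  have e1 : (2 : ℂ) ^ (-(6 * p : ℤ) - 1) = 1 / (2 * 2 ^ (6 * p)) := by
    rw [zpow_sub₀ h2, zpow_neg, zpow_one, show (6 * p : ℤ) = ((6 * p : ℕ) : ℤ) by push_cast; rfl,
      zpow_natCast]
    field_simp
  have e2 : (2 : ℂ) ^ ((6 * p : ℤ) + 2) = 4 * 2 ^ (6 * p) := by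
    rw [zpow_add₀ h2, show (6 * p : ℤ) = ((6 * p : ℕ) : ℤ) by push_cast; rfl, zpow_natCast]
    norm_num
    ring
  have e3 : ∀ j : ℕ, (2 : ℂ) ^ ((2 * j : ℤ) - 1) = 2 ^ (2 * j) / 2 := by
    intro j
    rw [zpow_sub₀ h2, show (2 * j : ℤ) = ((2 * j : ℕ) : ℤ) by push_cast; rfl, zpow_natCast,
      zpow_one]
  have hsum : ∀ j ∈ range p,
      ((4 * p - (2 * j + 1)).choose (2 * p) : ℂ) * twistedZeta 1 (2 * j + 2) *
        twistedZeta 1 (6 * p + 1 - 2 * j) *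
          (2 * (2 / 2 ^ (2 * j + 2) - 1) * (2 / 2 ^ (6 * p + 1 - 2 * j)) +
            4 * (2 / 2 ^ (6 * p + 1 - 2 * j) - 1)) =
      -2 * (1 / (2 * 2 ^ (6 * p)) * (((4 * p + 1 - 2 * (j + 1)).choose (2 * p) : ℂ) *
        (4 * 2 ^ (6 * p) - 2 ^ (2 * (j + 1)) / 2 - 1) * riemannZeta (2 * (j + 1 : ℕ)) *
          riemannZeta ((6 * p + 3 - 2 * (j + 1) : ℕ)))) := by
    intro j hj
    have hj := Finset.mem_range.1 hj
    obtain ⟨d, hd⟩ : ∃ d, 6 * p + 1 - 2 * j = d := ⟨_, rfl⟩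
    have hpow : (2 : ℂ) ^ (6 * p) * 2 = 2 ^ d * 2 ^ (2 * j) := by
      rw [← pow_succ, ← pow_add]
      congr 1
      omega
    rw [show (2 * ((j + 1 : ℕ) : ℂ)) = ((2 * j + 2 : ℕ) : ℂ) by push_cast; ring,
      show 6 * p + 3 - 2 * (j + 1) = 6 * p + 1 - 2 * j by omega,
      show 4 * p + 1 - 2 * (j + 1) = 4 * p - (2 * j + 1) by omega,
      ofReal_twistedZeta_one (by omega), ofReal_twistedZeta_one (by omega), hd]
    have hP' : (2 : ℂ) ^ (6 * p) = 2 ^ d * 2 ^ (2 * j) / 2 := by rw [← hpow]; ring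
    rw [hP', show 2 * (j + 1) = 2 * j + 2 by ring, pow_add (2 : ℂ) (2 * j) 2]
    have hd0 : (2 : ℂ) ^ d ≠ 0 := pow_ne_zero _ h2
    have hj0 : (2 : ℂ) ^ (2 * j) ≠ 0 := pow_ne_zero _ h2
    field_simp
    ring
  rw [Finset.sum_congr rfl hsum, ← Finset.mul_sum, ← Finset.mul_sum,
    ofReal_twistedZeta_one (by omega)] at hS
  rw [hR, e1, e2, Finset.sum_range_succ']
  simp only [e3]
  simp only [Nat.cast_zero, mul_zero, pow_zero, Nat.sub_zero, riemannZeta_zero]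
  rw [mul_add]
  have h0 : ((4 * p + 1).choose (2 * p) : ℂ) *
        (2 / 2 ^ (6 * p + 3) + 2 * (2 / 2 ^ (6 * p + 3) - 1)) * riemannZeta ((6 * p + 3 : ℕ)) =
      2 * (1 / (2 * 2 ^ (6 * p)) * (((4 * p + 1).choose (2 * p) : ℂ) *
        (4 * 2 ^ (6 * p) - 1 / 2 - 1) * (-1 / 2) * riemannZeta ((6 * p + 3 : ℕ)))) := by
    rw [pow_add]
    field_simp
    ring
  rw [h0] at hS
  linear_combination hS / 2
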